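/- arXiv:0910.4639 — 2 statements merged into one kernel-verified Lean document; each statement's English description precedes it below -/
import Mathlib

section
/- A commutative ring R is Gorenstein Von Neumann regular (every R-module is Gorenstein flat) if and only if every finitely presented R-module embeds in a flat R-module (i.e., for every finitely presented R-module M there exists a flat R-module F and an injective R-linear map M → F). -/
universe u

/-- An `R`-module `M` is **Gorenstein flat** if there exists an exact complex
`F : ⋯ → F₋₁ → F₀ → F₁ → ⋯` of flat `R`-modules with `M` isomorphic to the image
of `F₀ → F₁`, such that `I ⊗_R F` is exact for every injective `R`-module `I`. -/
def IsGorensteinFlat (R : Type u) [CommRing R] (M : Type u)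
    [AddCommGroup M] [Module R M] : Prop :=
  ∃ (F : ℤ → ModuleCat.{u} R) (d : ∀ i : ℤ, F i →ₗ[R] F (i + 1)),
    (∀ i, Module.Flat R (F i)) ∧
    (∀ i, LinearMap.range (d i) = LinearMap.ker (d (i + 1))) ∧
    Nonempty (M ≃ₗ[R] LinearMap.range (d 0)) ∧
    (∀ I : ModuleCat.{u} R, Module.Injective R I →
      ∀ i : ℤ, LinearMap.range (LinearMap.lTensor (R := R) (M := I) (d i)) =
        LinearMap.ker (LinearMap.lTensor (R := R) (M := I) (d (i + 1))))

/-- If every finitely presented `R`-module embeds in a flat module, then injective modules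
are flat. -/
theorem Module.Flat.of_injective_of_finitePresentation_embeds (R : Type u) [CommRing R]
    (H : ∀ (M : Type u) [AddCommGroup M] [Module R M], Module.FinitePresentation R M →
      ∃ F : ModuleCat.{u} R, Module.Flat R F ∧ ∃ f : M →ₗ[R] F, Function.Injective f)
    (I : Type u) [AddCommGroup I] [Module R I] [hI : Module.Injective R I] :
    Module.Flat R I := by
  refine Module.Flat.of_forall_exists_factorization fun {l f x} hx ↦ ?_
  let S : Submodule R (Fin l →₀ R) := R ∙ f
  have hS : S ≤ LinearMap.ker x := by simpa [S, Submodule.span_singleton_le_iff_mem] using hx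
  have hfp : Module.FinitePresentation R ((Fin l →₀ R) ⧸ S) :=
    Module.finitePresentation_of_surjective S.mkQ S.mkQ_surjective
      (by rw [Submodule.ker_mkQ]; exact Submodule.fg_span_singleton f)
  obtain ⟨F, _, j, hj⟩ := H _ hfp
  obtain ⟨h, hh⟩ := hI.out j hj (S.liftQ x hS)
  obtain ⟨k, a, y, hay⟩ := Module.Flat.exists_factorization_of_finitePresentation j
  refine ⟨k, a ∘ₗ S.mkQ, h ∘ₗ y, LinearMap.ext fun v ↦ ?_, ?_⟩
  · have := hh (S.mkQ v)
    rw [hay] at this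
    simpa using this.symm
  · have : S.mkQ f = 0 :=
      (Submodule.Quotient.mk_eq_zero S).mpr (Submodule.mem_span_singleton_self f)
    rw [LinearMap.comp_apply, this, map_zero]

/-- Every module embeds in an injective module. -/
theorem Module.exists_injective_embedding (R : Type u) [CommRing R]
    (M : Type u) [AddCommGroup M] [Module R M] :
    ∃ E : ModuleCat.{u} R, Module.Injective R E ∧ ∃ f : M →ₗ[R] E, Function.Injective f :=
  ⟨CategoryTheory.Injective.under (ModuleCat.of R M),
    (Module.injective_iff_injective_object R _).mpr
      (CategoryTheory.Injective.injective_under (ModuleCat.of R M)),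
    (CategoryTheory.Injective.ι (ModuleCat.of R M)).hom,
    (ModuleCat.mono_iff_injective _).mp inferInstance⟩

/-- A relation that is total on both sides has a two-sided infinite chain through any point. -/
theorem exists_int_chain {α : Type*} (r : α → α → Prop) (hr : ∀ a, ∃ b, r a b)
    (hl : ∀ b, ∃ a, r a b) (a : α) : ∃ K : ℤ → α, K 0 = a ∧ ∀ i, r (K i) (K (i + 1)) := by
  choose s hs using hr
  choose p hp using hl
  let K : ℤ → α
    | .ofNat n => Nat.rec a (fun _ b ↦ s b) n
    | .negSucc n => Nat.rec (p a) (fun _ b ↦ p b) n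
  refine ⟨K, rfl, fun i ↦ ?_⟩
  match i with
  | .ofNat n => exact hs _
  | .negSucc 0 => exact hp a
  | .negSucc (n + 1) => exact hp _

/-- `N` and `N'` are the ends of a short exact sequence with flat middle term. -/
def IsFlatSyzygy (R : Type u) [CommRing R] (N N' : ModuleCat.{u} R) : Prop :=
  ∃ F : ModuleCat.{u} R, Module.Flat R F ∧ ∃ p : F →ₗ[R] N', Function.Surjective p ∧
    ∃ j : N →ₗ[R] F, Function.Injective j ∧ LinearMap.range j = LinearMap.ker p

theorem exists_isFlatSyzygy_left (R : Type u) [CommRing R] (N' : ModuleCat.{u} R) :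
    ∃ N, IsFlatSyzygy R N N' := by
  let p : (N' →₀ R) →ₗ[R] N' := Finsupp.linearCombination R id
  exact ⟨.of R (LinearMap.ker p), .of R (N' →₀ R), inferInstanceAs (Module.Flat R (N' →₀ R)), p,
    Finsupp.linearCombination_id_surjective R N', (LinearMap.ker p).subtype,
    Subtype.val_injective, Submodule.range_subtype _⟩

theorem exists_isFlatSyzygy_right (R : Type u) [CommRing R]
    (H : ∀ I : ModuleCat.{u} R, Module.Injective R I → Module.Flat R I) (N : ModuleCat.{u} R) :
    ∃ N', IsFlatSyzygy R N N' := by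
  obtain ⟨E, hE, j, hj⟩ := Module.exists_injective_embedding R N
  exact ⟨.of R (E ⧸ LinearMap.range j), E, H E hE, (LinearMap.range j).mkQ,
    Submodule.mkQ_surjective _, j, hj, (Submodule.ker_mkQ _).symm⟩

/-- If injective modules are flat, then every module is Gorenstein flat. -/
theorem IsGorensteinFlat.of_injective_flat (R : Type u) [CommRing R]
    (H : ∀ I : ModuleCat.{u} R, Module.Injective R I → Module.Flat R I)
    (M : Type u) [AddCommGroup M] [Module R M] : IsGorensteinFlat R M := by
  obtain ⟨K, hK, hr⟩ := exists_int_chain (IsFlatSyzygy R) (exists_isFlatSyzygy_right R H)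
    (exists_isFlatSyzygy_left R) (ModuleCat.of R M)
  have step (i : ℤ) : ∃ F : ModuleCat.{u} R, Module.Flat R F ∧
      ∃ p : F →ₗ[R] K i, Function.Surjective p ∧ ∀ k, k + 1 = i →
        ∃ j : K k →ₗ[R] F, Function.Injective j ∧ LinearMap.range j = LinearMap.ker p := by
    obtain ⟨k, rfl⟩ : ∃ k, i = k + 1 := ⟨i - 1, by ring⟩
    obtain ⟨F, hF, p, hp, hj⟩ := hr k
    exact ⟨F, hF, p, hp, fun k' hk' ↦ by rwa [add_right_cancel hk']⟩
  choose F hF p hp j' using step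
  choose j hj hjp using fun i ↦ j' (i + 1) i rfl
  have hrange (i : ℤ) : LinearMap.range (j i ∘ₗ p i) = LinearMap.range (j i) :=
    LinearMap.range_comp_of_range_eq_top _ (LinearMap.range_eq_top.mpr (hp i))
  have hexact (i : ℤ) :
      LinearMap.range (j i ∘ₗ p i) = LinearMap.ker (j (i + 1) ∘ₗ p (i + 1)) := by
    rw [hrange, hjp, LinearMap.ker_comp_of_ker_eq_bot _ (LinearMap.ker_eq_bot.mpr (hj _))]
  refine ⟨F, fun i ↦ j i ∘ₗ p i, hF, hexact, ?_, fun I hI i ↦ ?_⟩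
  · rw [hrange]
    have e : M ≃ₗ[R] K 0 := by
      rw [hK]
    exact ⟨e.trans (LinearEquiv.ofInjective (j 0) (hj 0))⟩
  · have := H I hI
    exact (LinearMap.exact_iff.mp
      (Module.Flat.lTensor_exact I (LinearMap.exact_iff.mpr (hexact i).symm))).symm

/-- `R` is Gorenstein Von Neumann regular iff every finitely presented `R`-module embeds
in a flat `R`-module. -/
theorem gorensteinVonNeumannRegular_iff_finitelyPresented_embeds_in_flat
    (R : Type u) [CommRing R] :
    (∀ (M : Type u) [AddCommGroup M] [Module R M], IsGorensteinFlat R M) ↔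
    (∀ (M : Type u) [AddCommGroup M] [Module R M], Module.FinitePresentation R M →
      ∃ F : ModuleCat.{u} R, Module.Flat R F ∧
        ∃ f : M →ₗ[R] F, Function.Injective f) := by
  refine ⟨fun H M _ _ _ ↦ ?_, fun H M _ _ ↦ IsGorensteinFlat.of_injective_flat R
    (fun I _ ↦ Module.Flat.of_injective_of_finitePresentation_embeds R H I) M⟩
  obtain ⟨F, d, hF, -, ⟨e⟩, -⟩ := H M
  exact ⟨F (0 + 1), hF _, (LinearMap.range (d 0)).subtype ∘ₗ e.toLinearMap,
    Subtype.val_injective.comp e.injective⟩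
end

section
/- Let R be a coherent commutative ring. Then every injective R-module is flat if and only if every flat R-module is FP-injective. -/
universe u

/-- A commutative ring is **coherent** if every finitely generated ideal is finitely
presented (as an `R`-module). -/
def IsCoherentRing (R : Type u) [CommRing R] : Prop :=
  ∀ I : Ideal R, I.FG → Module.FinitePresentation R I

/-- An `R`-module `M` is **FP-injective** if `Ext¹_R(P, M) = 0` for every finitely
presented `R`-module `P`; equivalently, every short exact sequence `0 → M → E → P → 0`
with `P` finitely presented splits. -/
def IsFPInjective (R : Type u) [CommRing R] (M : Type u)
    [AddCommGroup M] [Module R M] : Prop :=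
  ∀ P : ModuleCat.{u} R, Module.FinitePresentation R P →
    ∀ (E : ModuleCat.{u} R) (i : M →ₗ[R] E) (p : E →ₗ[R] P),
      Function.Injective i → Function.Surjective p →
      LinearMap.range i = LinearMap.ker p →
      ∃ r : E →ₗ[R] M, r.comp i = LinearMap.id

namespace CharacterModule

variable {R A B C : Type*} [CommRing R] [AddCommGroup A] [Module R A] [AddCommGroup B]
  [Module R B] [AddCommGroup C] [Module R C]

/-- The evaluation map of a module into its double character module. -/
def eval (R A : Type*) [CommRing R] [AddCommGroup A] [Module R A] :
    A →ₗ[R] CharacterModule (CharacterModule A) where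
  toFun a := AddMonoidHom.eval (M := A) a
  map_add' a b := by
    ext c
    exact map_add c a b
  map_smul' _ _ := rfl

lemma eval_apply (a : A) (c : CharacterModule A) : eval R A a c = c a := rfl

lemma eval_injective : Function.Injective (eval R A) :=
  (injective_iff_map_eq_zero _).2 fun _ h ↦ eq_zero_of_character_apply fun c ↦ congr($h c)

lemma dual_eval_comp_eval :
    dual (eval R A) ∘ₗ eval R (CharacterModule A) = LinearMap.id := rfl

lemma dual_exact {f : A →ₗ[R] B} {g : B →ₗ[R] C} (hfg : Function.Exact f g)
    (hg : Function.Surjective g) : Function.Exact (dual g) (dual f) := by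
  intro φ
  constructor
  · intro hφ
    have hker : g.toAddMonoidHom.ker ≤ AddMonoidHom.ker (G := B) φ := by
      intro b hb
      obtain ⟨a, rfl⟩ := (hfg b).1 hb
      exact congr($hφ a)
    refine ⟨AddMonoidHom.liftOfSurjective g.toAddMonoidHom hg ⟨φ, hker⟩, ?_⟩
    ext b
    exact AddMonoidHom.liftOfRightInverse_comp_apply g.toAddMonoidHom _
      (Function.rightInverse_surjInv hg) ⟨φ, hker⟩ b
  · rintro ⟨ψ, rfl⟩
    rw [← LinearMap.comp_apply, ← dual_comp, hfg.linearMap_comp_eq_zero, dual_zero,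
      LinearMap.zero_apply]

end CharacterModule

open CharacterModule

lemma Module.Baer.of_retract {R M N : Type*} [CommRing R] [AddCommGroup M] [Module R M]
    [AddCommGroup N] [Module R N] (i : M →ₗ[R] N) (r : N →ₗ[R] M) (h : r ∘ₗ i = LinearMap.id)
    (hN : Module.Baer R N) : Module.Baer R M := by
  intro I g
  obtain ⟨g', hg'⟩ := hN I (i ∘ₗ g)
  refine ⟨r ∘ₗ g', fun x hx ↦ ?_⟩
  rw [LinearMap.comp_apply, hg' x hx]
  exact congr($h (g ⟨x, hx⟩))

/-- If the dual of `f : A → B` is a split epimorphism (that is, if `f` is pure) and `B` is flat,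
then the cokernel of `f` is flat. -/
lemma Module.Flat.quotient_range_of_dual_split {R A B : Type*} [CommRing R] [AddCommGroup A]
    [Module R A] [AddCommGroup B] [Module R B] [Module.Flat R B] (f : A →ₗ[R] B)
    (s : CharacterModule A →ₗ[R] CharacterModule B) (hs : dual f ∘ₗ s = LinearMap.id) :
    Module.Flat R (B ⧸ LinearMap.range f) := by
  have hexact : Function.Exact (dual (LinearMap.range f).mkQ) (dual f) :=
    dual_exact (LinearMap.exact_map_mkQ_range f) (Submodule.mkQ_surjective _)
  have hinj := dual_injective_of_surjective _ (Submodule.mkQ_surjective (LinearMap.range f))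
  obtain ⟨-, r, hr⟩ := (hexact.split_tfae'.out 0 1 rfl rfl).1 ⟨hinj, s, hs⟩
  exact Module.Flat.iff_characterModule_baer.2
    (.of_retract _ r hr (Module.Flat.iff_characterModule_baer.1 ‹_›))

/-- A submodule of an injective module with flat cokernel is FP-injective. -/
lemma IsFPInjective.of_flat_quotient {R : Type u} [CommRing R] {M J : Type u} [AddCommGroup M]
    [Module R M] [AddCommGroup J] [Module R J] (hJ : Module.Injective R J) (f : M →ₗ[R] J)
    (hf : Function.Injective f) [Module.Flat R (J ⧸ LinearMap.range f)] :
    IsFPInjective R M := by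
  intro P _ E i p hi hp hip
  obtain ⟨g, hg⟩ := hJ.out i hi f
  have hker : LinearMap.ker p ≤ LinearMap.ker ((LinearMap.range f).mkQ ∘ₗ g) := by
    rw [← hip]
    rintro _ ⟨m, rfl⟩
    simp [hg]
  obtain ⟨q, hq⟩ : ∃ q : P →ₗ[R] J ⧸ LinearMap.range f,
      q ∘ₗ p = (LinearMap.range f).mkQ ∘ₗ g := by
    refine ⟨(LinearMap.ker p).liftQ _ hker ∘ₗ (p.quotKerEquivOfSurjective hp).symm, ?_⟩
    ext e
    have : (p.quotKerEquivOfSurjective hp).symm (p e) = Submodule.Quotient.mk e := by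
      rw [LinearEquiv.symm_apply_eq]
      rfl
    simp [this]
  obtain ⟨k, h₂, h₃, rfl⟩ := Module.Flat.exists_factorization_of_finitePresentation q
  obtain ⟨l, hl⟩ := Module.projective_lifting_property _ h₃
    (Submodule.mkQ_surjective (LinearMap.range f))
  have hmem (e : E) : (g - l ∘ₗ h₂ ∘ₗ p) e ∈ LinearMap.range f := by
    rw [← Submodule.ker_mkQ (LinearMap.range f), LinearMap.mem_ker, LinearMap.sub_apply, map_sub,
      sub_eq_zero]
    exact congr($hq e).symm.trans congr($hl (h₂ (p e))).symm
  refine ⟨(LinearEquiv.ofInjective f hf).symm ∘ₗ (g - l ∘ₗ h₂ ∘ₗ p).codRestrict _ hmem, ?_⟩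
  ext m
  have hpm : p (i m) = 0 := by
    rw [← LinearMap.mem_ker, ← hip]
    exact ⟨m, rfl⟩
  simp only [LinearMap.comp_apply, LinearMap.id_apply, LinearEquiv.coe_coe]
  rw [LinearEquiv.symm_apply_eq]
  ext
  simp [hpm, hg]

/-- Linear maps from a finitely generated ideal to an FP-injective module extend to the ring. -/
lemma IsFPInjective.exists_smul_eq {R : Type u} [CommRing R] {M : Type u} [AddCommGroup M]
    [Module R M] (hM : IsFPInjective R M) {J : Ideal R} (hJ : J.FG) (φ : J →ₗ[R] M) :
    ∃ t : M, ∀ j : J, φ j = (j : R) • t := by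
  let S : Submodule R (M × R) := LinearMap.range (φ.prod (-J.subtype))
  have hS : S ≤ LinearMap.ker (J.mkQ ∘ₗ LinearMap.snd R M R) := by
    rintro _ ⟨j, rfl⟩
    simp [Ideal.Quotient.eq_zero_iff_mem]
  have hP : Module.FinitePresentation R (R ⧸ J) :=
    Module.finitePresentation_of_surjective J.mkQ J.mkQ_surjective (by rwa [Submodule.ker_mkQ])
  obtain ⟨r, hr⟩ := hM (ModuleCat.of R (R ⧸ J)) hP (ModuleCat.of R ((M × R) ⧸ S))
    (S.mkQ ∘ₗ LinearMap.inl R M R) (S.liftQ _ hS)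
    (by
      rw [injective_iff_map_eq_zero]
      intro m hm
      obtain ⟨j, hj⟩ := (Submodule.Quotient.mk_eq_zero S).1 hm
      have h₁ : φ j = m := congr($hj.1)
      have h₂ : -(j : R) = 0 := congr($hj.2)
      have h₃ : j = 0 := Subtype.ext (neg_eq_zero.1 h₂)
      rw [← h₁, h₃, map_zero])
    (by
      intro z
      obtain ⟨x, rfl⟩ := J.mkQ_surjective z
      exact ⟨S.mkQ (0, x), rfl⟩)
    (by
      apply le_antisymm
      · rintro _ ⟨m, rfl⟩
        exact map_zero J.mkQ
      · intro z hz
        obtain ⟨⟨m, x⟩, rfl⟩ := S.mkQ_surjective z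
        have hx : x ∈ J := (Submodule.Quotient.mk_eq_zero J).1 hz
        refine ⟨m + φ ⟨x, hx⟩, (Submodule.Quotient.eq S).2 ⟨⟨x, hx⟩, ?_⟩⟩
        simp)
  refine ⟨r (S.mkQ (0, 1)), fun j ↦ ?_⟩
  have hj : S.mkQ (φ j, 0) = (j : R) • S.mkQ (0, 1) := by
    rw [← map_smul]
    refine (Submodule.Quotient.eq S).2 ⟨j, ?_⟩
    simp
  rw [← map_smul]
  exact congr($hr (φ j)).symm.trans congr(r $hj)

/-- Over a self-FP-injective ring, a vector orthogonal to all syzygies of `a` is a multiple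
of `a`. -/
lemma IsFPInjective.exists_eq_mul_of_ker_le {R : Type u} [CommRing R] (hR : IsFPInjective R R)
    {n : ℕ} {a c : Fin n → R}
    (h : LinearMap.ker (Fintype.linearCombination R a) ≤
      LinearMap.ker (Fintype.linearCombination R c)) :
    ∃ t, ∀ i, c i = a i * t := by
  let l := Fintype.linearCombination R a
  have hJ : (LinearMap.range l).FG := Module.Finite.iff_fg.1 inferInstance
  obtain ⟨t, ht⟩ := hR.exists_smul_eq (J := LinearMap.range l) hJ
    ((LinearMap.ker l).liftQ _ h ∘ₗ l.quotKerEquivRange.symm)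
  refine ⟨t, fun i ↦ ?_⟩
  have hi := ht (l.quotKerEquivRange (Submodule.Quotient.mk (Pi.single i 1)))
  simpa [l, Fintype.linearCombination_apply_single] using hi

/-- Injective modules over a coherent self-FP-injective ring are flat. -/
lemma Module.Injective.flat_of_isFPInjective {R : Type u} [CommRing R] (hcoh : IsCoherentRing R)
    (hR : IsFPInjective R R) {I : Type u} [AddCommGroup I] [Module R I]
    (hI : Module.Injective R I) : Module.Flat R I := by
  refine Module.Flat.of_forall_isTrivialRelation fun {n a x} hax ↦ ?_
  let l := Fintype.linearCombination R a
  have : Module.FinitePresentation R (LinearMap.range l) :=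
    hcoh (LinearMap.range l) (Module.Finite.iff_fg.1 inferInstance)
  have hfg : (LinearMap.ker l).FG := by
    simpa using Module.FinitePresentation.fg_ker l.rangeRestrict l.surjective_rangeRestrict
  obtain ⟨m, g, hg⟩ := (Submodule.fg_iff_exists_fin_linearMap R _).1 hfg
  let b : Fin n → Fin m → R := fun i j ↦ g (Pi.single j 1) i
  let β := Fintype.linearCombination R b
  let ξ := Fintype.linearCombination R x
  have hker : LinearMap.ker β ≤ LinearMap.ker ξ := by
    intro c hc
    have horth : LinearMap.ker l ≤ LinearMap.ker (Fintype.linearCombination R c) := by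
      rw [← hg, LinearMap.range_le_ker_iff]
      ext j
      have hj : β c j = 0 := congr($hc j)
      simpa [β, b, Fintype.linearCombination_apply, mul_comm] using hj
    obtain ⟨t, ht⟩ := hR.exists_eq_mul_of_ker_le horth
    simp [ξ, Fintype.linearCombination_apply, ht, mul_comm _ t, mul_smul, ← Finset.smul_sum, hax]
  obtain ⟨h, hh⟩ := hI.out ((LinearMap.ker β).liftQ β le_rfl)
    (LinearMap.ker_eq_bot.1 (Submodule.ker_liftQ_eq_bot _ _ _ le_rfl))
    ((LinearMap.ker β).liftQ ξ hker)
  refine ⟨m, b, fun j ↦ h (Pi.single j 1), fun i ↦ ?_, fun j ↦ ?_⟩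
  · have hi := hh (Submodule.Quotient.mk (Pi.single i 1))
    simp only [Submodule.liftQ_apply, β, ξ, Fintype.linearCombination_apply_single, one_smul] at hi
    rw [← hi, LinearMap.pi_apply_eq_sum_univ h (b i)]
    refine Finset.sum_congr rfl fun j _ ↦ ?_
    congr 2
    ext k
    simp [Pi.single_apply, eq_comm]
  · have hj : g (Pi.single j 1) ∈ LinearMap.ker l := hg ▸ LinearMap.mem_range_self g _
    simpa [l, b, Fintype.linearCombination_apply, mul_comm] using hj

/-- For a coherent commutative ring `R`, every injective `R`-module is flat iff every
flat `R`-module is FP-injective. -/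
theorem coherent_injective_flat_iff_flat_fpInjective (R : Type u) [CommRing R]
    (hcoh : IsCoherentRing R) :
    (∀ (I : Type u) [AddCommGroup I] [Module R I],
      Module.Injective R I → Module.Flat R I) ↔
    (∀ (F : Type u) [AddCommGroup F] [Module R F],
      Module.Flat R F → IsFPInjective R F) := by
  refine ⟨fun h F _ _ _ ↦ ?_, fun h I _ _ hI ↦
    hI.flat_of_isFPInjective hcoh (h R inferInstance)⟩
  have : Module.Flat R (CharacterModule F) :=
    h _ (Module.Flat.iff_characterModule_injective.1 inferInstance)
  have hinj : Module.Injective R (CharacterModule (CharacterModule F)) :=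
    Module.Flat.iff_characterModule_injective.1 inferInstance
  have : Module.Flat R (CharacterModule (CharacterModule F)) := h _ hinj
  have := Module.Flat.quotient_range_of_dual_split (eval R F) (eval R (CharacterModule F))
    dual_eval_comp_eval
  exact .of_flat_quotient hinj (eval R F) eval_injective
end
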